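/- Let (Ω, 𝔉, P) be a probability space and A : Ω → Set ℝ a map with A(ω) ⊆ [0,1] for every ω, such that for every n ≥ 1 and every 1 ≤ k ≤ 2^n the event D(n,k) := {ω : A(ω) ∩ [(k−1)·2^{−n}, k·2^{−n}] ≠ ∅} is measurable. Suppose s ∈ (0,1) and there exist a constant C < ∞ and N ∈ ℕ such that for all n ≥ N one has ∑_{k=1}^{2^n} P(D(n,k)) ≤ C·2^{s·n}. Then for P-almost every ω, the Hausdorff dimension of A(ω) is at most s. -/

import Mathlib

open MeasureTheory Set

/-- First-moment upper bound on the Hausdorff dimension of a random subset of `[0,1]`: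
if the expected number of `n`-th generation dyadic intervals hit by the random set
is eventually bounded by `C * 2 ^ (s * n)`, then the Hausdorff dimension is a.s. at most `s`. -/
theorem stmt_0 {Ω : Type*} [MeasurableSpace Ω] (P : Measure Ω) [IsProbabilityMeasure P]
    (A : Ω → Set ℝ) (hA : ∀ ω, A ω ⊆ Icc 0 1)
    (hmeas : ∀ n k : ℕ, 1 ≤ n → 1 ≤ k → k ≤ 2 ^ n →
      MeasurableSet
        {ω | (A ω ∩ Icc (((k : ℝ) - 1) / 2 ^ n) ((k : ℝ) / 2 ^ n)).Nonempty})
    (s : ℝ) (hs : s ∈ Ioo (0 : ℝ) 1) (C : ℝ) (N : ℕ)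
    (hbound : ∀ n : ℕ, N ≤ n →
      ∑ k ∈ Finset.Icc (1 : ℕ) (2 ^ n),
          (P {ω | (A ω ∩ Icc (((k : ℝ) - 1) / 2 ^ n) ((k : ℝ) / 2 ^ n)).Nonempty}).toReal
        ≤ C * (2 : ℝ) ^ (s * n)) :
    ∀ᵐ ω ∂P, dimH (A ω) ≤ ENNReal.ofReal s := by
  obtain ⟨hs0, hs1⟩ := hs
  let D : ℕ → ℕ → Set Ω := fun n k =>
    {ω | (A ω ∩ Icc (((k : ℝ) - 1) / 2 ^ n) ((k : ℝ) / 2 ^ n)).Nonempty}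
  let r : ℕ → ENNReal := fun n => ENNReal.ofReal (((2 : ℝ) ^ (n + N + 1))⁻¹)
  let F : ℕ → Ω → ENNReal := fun n ω =>
    ∑ k ∈ Finset.Icc (1 : ℕ) (2 ^ (n + N + 1)), (D (n + N + 1) k).indicator (fun _ => r n ^ s) ω
  have hD : ∀ n, ∀ k ∈ Finset.Icc (1 : ℕ) (2 ^ (n + N + 1)), MeasurableSet (D (n + N + 1) k) := by
    intro n k hk
    rw [Finset.mem_Icc] at hk
    exact hmeas _ k (by omega) hk.1 hk.2
  have hFm : ∀ n, Measurable (F n) := by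
    intro n
    exact Finset.measurable_fun_sum _ fun k hk => measurable_const.indicator (hD n k hk)
  have hFint : ∀ n, ∫⁻ ω, F n ω ∂P ≤ ENNReal.ofReal C := by
    intro n
    have h1 : ∫⁻ ω, F n ω ∂P =
        ∑ k ∈ Finset.Icc (1 : ℕ) (2 ^ (n + N + 1)), r n ^ s * P (D (n + N + 1) k) := by
      rw [lintegral_finsetSum' _ fun k hk =>
        (measurable_const.indicator (hD n k hk)).aemeasurable]
      exact Finset.sum_congr rfl fun k hk => lintegral_indicator_const (hD n k hk) _
    have hb := hbound (n + N + 1) (by omega)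
    have h2 : ∑ k ∈ Finset.Icc (1 : ℕ) (2 ^ (n + N + 1)), P (D (n + N + 1) k) ≤
        ENNReal.ofReal (C * (2 : ℝ) ^ (s * ((n + N + 1 : ℕ) : ℝ))) := by
      rw [← ENNReal.toReal_sum (fun k _ => measure_ne_top P _)] at hb
      exact (ENNReal.le_ofReal_iff_toReal_le
        (ENNReal.sum_ne_top.2 fun k _ => measure_ne_top P _)
        (le_trans ENNReal.toReal_nonneg hb)).2 hb
    rw [h1, ← Finset.mul_sum]
    refine (mul_le_mul_right h2 _).trans ?_
    have h3 : r n ^ s = ENNReal.ofReal (((2 : ℝ) ^ (s * ((n + N + 1 : ℕ) : ℝ)))⁻¹) := by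
      simp only [r]
      rw [ENNReal.ofReal_rpow_of_pos (by positivity), Real.inv_rpow (by positivity),
        ← Real.rpow_natCast, ← Real.rpow_mul (by norm_num), mul_comm s]
    rw [h3, ← ENNReal.ofReal_mul (by positivity)]
    apply ENNReal.ofReal_le_ofReal
    have : (2 : ℝ) ^ (s * ((n + N + 1 : ℕ) : ℝ)) ≠ 0 := by positivity
    apply le_of_eq
    field_simp
  have hlim : ∫⁻ ω, Filter.liminf (fun n => F n ω) Filter.atTop ∂P ≠ ⊤ := by
    refine ne_top_of_le_ne_top (ENNReal.ofReal_ne_top (r := C)) ?_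
    refine (lintegral_liminf_le hFm).trans ?_
    refine (Filter.liminf_le_liminf (Filter.Eventually.of_forall hFint)).trans ?_
    simp
  have hae := ae_lt_top (Measurable.liminf hFm) hlim
  filter_upwards [hae] with ω hω
  have hr : Filter.Tendsto r Filter.atTop (nhds 0) := by
    have h1 : Filter.Tendsto (fun n : ℕ => ((1 / 2 : ℝ)) ^ (n + (N + 1))) Filter.atTop (nhds 0) :=
      (Filter.tendsto_add_atTop_iff_nat (N + 1)).2
        (tendsto_pow_atTop_nhds_zero_of_lt_one (by norm_num) (by norm_num))
    have h2 := ENNReal.tendsto_ofReal h1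
    simpa [r, add_assoc] using h2
  let t : ∀ n : ℕ, Finset.Icc (1 : ℕ) (2 ^ (n + N + 1)) → Set ℝ := fun n k =>
    A ω ∩ Icc (((k : ℕ) - 1 : ℝ) / 2 ^ (n + N + 1)) (((k : ℕ) : ℝ) / 2 ^ (n + N + 1))
  have htd : ∀ n k, Metric.ediam (t n k) ≤ r n := by
    intro n k
    refine (Metric.ediam_mono inter_subset_right).trans ?_
    rw [Real.ediam_Icc]
    apply ENNReal.ofReal_le_ofReal
    apply le_of_eq
    ring
  have hcov : ∀ n, A ω ⊆ ⋃ k, t n k := by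
    intro n x hx
    obtain ⟨hx0, hx1⟩ := hA ω hx
    have hp : (0 : ℝ) < 2 ^ (n + N + 1) := by positivity
    have hmem : max 1 ⌈x * 2 ^ (n + N + 1)⌉₊ ∈ Finset.Icc (1 : ℕ) (2 ^ (n + N + 1)) := by
      rw [Finset.mem_Icc]
      refine ⟨le_max_left _ _, max_le Nat.one_le_two_pow (Nat.ceil_le.2 ?_)⟩
      push_cast
      nlinarith
    refine mem_iUnion.2 ⟨⟨_, hmem⟩, hx, ?_, ?_⟩
    · rw [div_le_iff₀ hp]
      have h0 : 0 ≤ x * 2 ^ (n + N + 1) := by positivity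
      have := Nat.ceil_lt_add_one h0
      push_cast
      rw [sub_le_iff_le_add]
      exact max_le (by linarith) this.le
    · rw [le_div_iff₀ hp]
      refine (Nat.le_ceil _).trans ?_
      exact_mod_cast le_max_right _ _
  have hH : μH[s] (A ω) ≤ Filter.liminf (fun n => F n ω) Filter.atTop := by
    refine (Measure.hausdorffMeasure_le_liminf_sum s (A ω) r hr t
      (Filter.Eventually.of_forall htd) (Filter.Eventually.of_forall hcov)).trans ?_
    refine Filter.liminf_le_liminf (Filter.Eventually.of_forall fun n => ?_)
    simp only [F]
    rw [← Finset.sum_coe_sort (Finset.Icc (1 : ℕ) (2 ^ (n + N + 1)))]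
    apply Finset.sum_le_sum
    intro k _
    by_cases hk : ω ∈ D (n + N + 1) k
    · rw [indicator_of_mem hk]
      exact ENNReal.rpow_le_rpow (htd n k) hs0.le
    · have : t n k = ∅ := not_nonempty_iff_eq_empty.1 hk
      rw [this, Metric.ediam_empty, ENNReal.zero_rpow_of_pos hs0]
      exact zero_le
  refine dimH_le_of_hausdorffMeasure_ne_top (d := s.toNNReal) ?_
  rw [Real.coe_toNNReal s hs0.le]
  exact (hH.trans_lt hω).ne
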